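/- Every bipartite planar graph has star arboricity at most 4: its edge set can be partitioned into at most 4 star forests. -/

import Mathlib

/-- A planar embedding of a graph `G`: points for the vertices and, for each edge, a
Jordan arc (continuous injective curve) joining the images of its endpoints, such that
the open arcs avoid all vertex points and the open arcs of distinct edges are
disjoint. -/
structure PlanarEmbedding {V : Type*} (G : SimpleGraph V) where
  vpos : V → ℝ × ℝ
  vpos_inj : Function.Injective vpos
  arc : Sym2 V → ℝ → ℝ × ℝ
  arc_cont : ∀ e ∈ G.edgeSet, ContinuousOn (arc e) (Set.Icc 0 1)
  arc_inj : ∀ e ∈ G.edgeSet, Set.InjOn (arc e) (Set.Icc 0 1)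
  arc_ends : ∀ e ∈ G.edgeSet, arc e '' ({0, 1} : Set ℝ) = vpos '' {v | v ∈ e}
  arc_avoid : ∀ e ∈ G.edgeSet, ∀ v : V, vpos v ∉ arc e '' Set.Ioo 0 1
  arc_disjoint : ∀ e ∈ G.edgeSet, ∀ f ∈ G.edgeSet, e ≠ f →
    arc e '' Set.Ioo 0 1 ∩ arc f '' Set.Ioo 0 1 = ∅

/-- A graph is planar if it admits a planar embedding. -/
def IsPlanar {V : Type*} (G : SimpleGraph V) : Prop := Nonempty (PlanarEmbedding G)

/-- A star forest: a forest in which every component is a star; equivalently, every edge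
has an endpoint that is a leaf. -/
def IsStarForest {V : Type*} (S : SimpleGraph V) : Prop :=
  ∀ u v, S.Adj u v → (∀ x, S.Adj u x → x = v) ∨ (∀ x, S.Adj v x → x = u)

/-- The endpoint of a unit edge of the square grid `ℤ × ℤ` other than its lower left endpoint
`ε.1`; the edge is horizontal if `ε.2` is `true` and vertical otherwise. -/
def gridNext (ε : (ℤ × ℤ) × Bool) : ℤ × ℤ :=
  if ε.2 then (ε.1.1 + 1, ε.1.2) else (ε.1.1, ε.1.2 + 1)

/-- Unit squares of the grid are named by their lower left corners. A grid edge `ε` separates the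
squares `ε.1` and `gridBack ε`. -/
def gridBack (ε : (ℤ × ℤ) × Bool) : ℤ × ℤ :=
  if ε.2 then (ε.1.1, ε.1.2 - 1) else (ε.1.1 - 1, ε.1.2)

/-- A step between adjacent grid points of `S`. -/
def GridStep (S : Set (ℤ × ℤ)) (p q : ℤ × ℤ) : Prop :=
  p ∈ S ∧ q ∈ S ∧ ∃ b, q = gridNext (p, b) ∨ p = gridNext (q, b)

/-- The boundary operator modulo 2 from edge chains to vertex chains of the grid. -/
def gridBoundary : ((ℤ × ℤ) × Bool → ZMod 2) →ₗ[ZMod 2] (ℤ × ℤ → ZMod 2) where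
  toFun z p := z (p, true) + z ((p.1 - 1, p.2), true) + z (p, false) + z ((p.1, p.2 - 1), false)
  map_add' x y := by ext p; simp only [Pi.add_apply]; ring
  map_smul' a x := by ext p; simp only [Pi.smul_apply, smul_eq_mul, RingHom.id_apply]; ring

theorem gridBoundary_apply (z : (ℤ × ℤ) × Bool → ZMod 2) (p : ℤ × ℤ) :
    gridBoundary z p =
      z (p, true) + z ((p.1 - 1, p.2), true) + z (p, false) + z ((p.1, p.2 - 1), false) := rfl

theorem gridBoundary_single (ε : (ℤ × ℤ) × Bool) (a : ZMod 2) :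
    gridBoundary (Pi.single ε a) = Pi.single ε.1 a + Pi.single (gridNext ε) a := by
  obtain ⟨⟨i, j⟩, b⟩ := ε
  ext ⟨k, l⟩
  have h1 : (k = i + 1 ∧ l = j) ↔ (k - 1 = i ∧ l = j) := by omega
  have h2 : (k = i ∧ l = j + 1) ↔ (k = i ∧ l - 1 = j) := by omega
  cases b <;> simp [gridBoundary_apply, gridNext, Pi.single_apply, h1, h2]

theorem gridStep_symm {S : Set (ℤ × ℤ)} {p q : ℤ × ℤ} (h : GridStep S p q) : GridStep S q p := by
  obtain ⟨hp, hq, b, hb⟩ := h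
  exact ⟨hq, hp, b, hb.symm⟩

/-- Two points joined by a grid path in `S` are the boundary of a chain of edges inside `S`. -/
theorem exists_chain_of_path {S : Set (ℤ × ℤ)} {p q : ℤ × ℤ}
    (h : Relation.ReflTransGen (GridStep S) p q) :
    ∃ J : (ℤ × ℤ) × Bool → ZMod 2, (∀ ε, J ε ≠ 0 → ε.1 ∈ S ∧ gridNext ε ∈ S) ∧
      gridBoundary J = Pi.single p 1 + Pi.single q 1 := by
  induction h with
  | refl => exact ⟨0, by simp, by rw [CharTwo.add_self_eq_zero, map_zero]⟩
  | @tail q r _ hs ih =>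
    obtain ⟨J, hJ, hb⟩ := ih
    obtain ⟨hq, hr, b, hstep⟩ := hs
    have key : ∀ ε : (ℤ × ℤ) × Bool, ε.1 ∈ S → gridNext ε ∈ S →
        (Pi.single ε.1 1 + Pi.single (gridNext ε) 1 : ℤ × ℤ → ZMod 2) =
          Pi.single q 1 + Pi.single r 1 →
        ∃ J : (ℤ × ℤ) × Bool → ZMod 2, (∀ ε, J ε ≠ 0 → ε.1 ∈ S ∧ gridNext ε ∈ S) ∧
          gridBoundary J = Pi.single p 1 + Pi.single r 1 := by
      intro ε h1 h2 h3
      refine ⟨J + Pi.single ε 1, fun η hη => ?_, ?_⟩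
      · by_cases hε : η = ε
        · subst hε; exact ⟨h1, h2⟩
        · exact hJ η (by simpa [hε] using hη)
      · rw [map_add, hb, gridBoundary_single, h3, add_assoc, ← add_assoc (Pi.single q 1),
          CharTwo.add_self_eq_zero, zero_add]
    rcases hstep with rfl | rfl
    · exact key (q, b) hq hr rfl
    · exact key (r, b) hr hq (add_comm _ _)

theorem exists_int_antideriv (g : ℤ → ZMod 2) :
    ∃ F : ℤ → ZMod 2, F 0 = 0 ∧ ∀ i, F i = F (i - 1) + g i := by
  refine ⟨fun i => ∑ k ∈ Finset.Ioc 0 i, g k + ∑ k ∈ Finset.Ioc i 0, g k, by simp, fun i => ?_⟩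
  rcases le_or_gt i 0 with hi | hi
  · have h : Finset.Ioc (i - 1) 0 = insert i (Finset.Ioc i 0) := by
      ext k; simp only [Finset.mem_Ioc, Finset.mem_insert]; omega
    simp only [h, Finset.Ioc_eq_empty_of_le hi, Finset.Ioc_eq_empty_of_le (show i - 1 ≤ 0 by omega)]
    rw [Finset.sum_insert (by simp), Finset.sum_empty, zero_add, zero_add, add_right_comm,
      CharTwo.add_self_eq_zero, zero_add]
  · have h : Finset.Ioc 0 i = insert i (Finset.Ioc 0 (i - 1)) := by
      ext k; simp only [Finset.mem_Ioc, Finset.mem_insert]; omega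
    simp only [h, Finset.Ioc_eq_empty_of_le hi.le,
      Finset.Ioc_eq_empty_of_le (show 0 ≤ i - 1 by omega)]
    rw [Finset.sum_insert (by simp), Finset.sum_empty]
    ring

/-- The jump of a function on unit squares across each grid edge. -/
def gridJump (c : ℤ × ℤ → ZMod 2) (ε : (ℤ × ℤ) × Bool) : ZMod 2 := c ε.1 + c (gridBack ε)

theorem gridBoundary_gridJump (c : ℤ × ℤ → ZMod 2) : gridBoundary (gridJump c) = 0 := by
  ext ⟨i, j⟩
  simp only [gridBoundary_apply, gridJump, gridBack, Pi.zero_apply, if_true]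
  simp only [Bool.false_eq_true, if_false]
  linear_combination CharTwo.add_self_eq_zero (c (i, j)) + CharTwo.add_self_eq_zero (c (i, j - 1))
    + CharTwo.add_self_eq_zero (c (i - 1, j)) + CharTwo.add_self_eq_zero (c (i - 1, j - 1))

/-- Every cycle modulo 2 in the grid bounds a set of unit squares. -/
theorem exists_gridJump_eq {z : (ℤ × ℤ) × Bool → ZMod 2} (hz : gridBoundary z = 0) :
    ∃ c, gridJump c = z := by
  obtain ⟨a, -, ha⟩ := exists_int_antideriv fun j => z ((0, j), true)
  choose F hF0 hF using fun j => exists_int_antideriv fun i => z ((i, j), false)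
  have hc : ∀ i j, z ((i, j), true) = a j + F j i + (a (j - 1) + F (j - 1) i) := by
    intro i j
    have step : ∀ i, z ((i, j), true) + F j i + F (j - 1) i =
        z ((i - 1, j), true) + F j (i - 1) + F (j - 1) (i - 1) := by
      intro i
      have h := congrFun hz (i, j)
      rw [gridBoundary_apply] at h
      simp only [Pi.zero_apply] at h
      rw [hF j i, hF (j - 1) i]
      linear_combination h - CharTwo.add_self_eq_zero (z ((i - 1, j), true))
    have const : ∀ i, z ((i, j), true) + F j i + F (j - 1) i = z ((0, j), true) := by
      intro i
      induction i using Int.induction_on with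
      | zero => simp [hF0]
      | succ i ih => rw [step, add_sub_cancel_right, ih]
      | pred i ih => rw [← step, ih]
    linear_combination const i - ha j
      - CharTwo.add_self_eq_zero (a (j - 1))
      - CharTwo.add_self_eq_zero (F j i) - CharTwo.add_self_eq_zero (F (j - 1) i)
  refine ⟨fun s => a s.2 + F s.2 s.1, ?_⟩
  ext ⟨⟨i, j⟩, b⟩
  cases b
  · simp only [gridJump, gridBack, Bool.false_eq_true, if_false]
    rw [hF j i]
    linear_combination CharTwo.add_self_eq_zero (a j) + CharTwo.add_self_eq_zero (F j (i - 1))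
  · simp [gridJump, gridBack, hc]

/-- A model of the bipartite graph with edges `src i — tgt i` as a minor of the square grid:
disjoint finite connected branch sets, with a grid edge between the branch sets of the two ends
of each edge. -/
structure IsGridMinor {V ι : Type*} (B : V → Set (ℤ × ℤ)) (src tgt : ι → V) : Prop where
  finite : ∀ v, (B v).Finite
  nonempty : ∀ v, (B v).Nonempty
  disjoint : ∀ u v p, p ∈ B u → p ∈ B v → u = v
  connected : ∀ v, ∀ p ∈ B v, ∀ q ∈ B v, Relation.ReflTransGen (GridStep (B v)) p q
  edge : ∀ i, ∃ ε, (ε.1 ∈ B (src i) ∧ gridNext ε ∈ B (tgt i)) ∨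
    (ε.1 ∈ B (tgt i) ∧ gridNext ε ∈ B (src i))

section Incidence

variable {V ι : Type*} [Fintype ι] [DecidableEq V]

/-- The boundary operator modulo 2 of the graph with edges `src i — tgt i`. -/
def incidence (src tgt : ι → V) : (ι → ZMod 2) →ₗ[ZMod 2] (V → ZMod 2) where
  toFun z := ∑ i, z i • (Pi.single (src i) 1 + Pi.single (tgt i) 1)
  map_add' x y := by simp only [Pi.add_apply, add_smul, Finset.sum_add_distrib]
  map_smul' a x := by
    simp only [Pi.smul_apply, smul_eq_mul, mul_smul, Finset.smul_sum, RingHom.id_apply]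

theorem incidence_apply (src tgt : ι → V) (z : ι → ZMod 2) (v : V) :
    incidence src tgt z v =
      ∑ i, z i * ((if v = src i then 1 else 0) + (if v = tgt i then 1 else 0)) := by
  simp [incidence, Finset.sum_apply, Pi.single_apply, mul_add]

theorem incidence_swap (src tgt : ι → V) : incidence tgt src = incidence src tgt := by
  ext1 z
  simp only [incidence, add_comm]

theorem exists_ne_of_incidence_eq_zero {src tgt : ι → V} (hbip : ∀ i j, src i ≠ tgt j)
    {z : ι → ZMod 2} (hz : incidence src tgt z = 0) {i : ι} (hi : z i ≠ 0) :
    ∃ j, j ≠ i ∧ z j ≠ 0 ∧ src j = src i := by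
  by_contra! hcon
  have h := congrFun hz (src i)
  rw [incidence_apply, Finset.sum_eq_single i] at h
  · simp [hbip i i] at h
    exact hi h
  · intro j _ hji
    by_cases hj : z j = 0
    · simp [hj]
    · simp [(hcon j hji hj).symm, hbip i j]
  · simp

/-- A nonzero cycle modulo 2 of a simple bipartite graph has at least four edges. -/
theorem four_le_card_support {src tgt : ι → V} (hbip : ∀ i j, src i ≠ tgt j)
    (hinj : ∀ i j, src i = src j → tgt i = tgt j → i = j)
    {z : ι → ZMod 2} (hz : incidence src tgt z = 0) (hne : z ≠ 0) :
    4 ≤ (Finset.univ.filter fun i => z i ≠ 0).card := by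
  classical
  have hz' : incidence tgt src z = 0 := by rw [incidence_swap, hz]
  have hbip' : ∀ i j, tgt i ≠ src j := fun i j => (hbip j i).symm
  obtain ⟨i, hi⟩ := Function.ne_iff.mp hne
  obtain ⟨j, hji, hj, hsj⟩ := exists_ne_of_incidence_eq_zero hbip hz hi
  obtain ⟨k, hki, hk, htk⟩ := exists_ne_of_incidence_eq_zero hbip' hz' hi
  obtain ⟨l, hlj, hl, htl⟩ := exists_ne_of_incidence_eq_zero hbip' hz' hj
  have hkj : k ≠ j := by rintro rfl; exact hji (hinj _ _ hsj htk)
  have hli : l ≠ i := by rintro rfl; exact hlj (hinj _ _ hsj.symm htl)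
  have hlk : l ≠ k := by
    rintro rfl
    exact hji (hinj _ _ hsj (htl.symm.trans htk))
  have hsub : ({i, j, k, l} : Finset ι) ⊆ Finset.univ.filter fun i => z i ≠ 0 := by
    intro x hx
    simp only [Finset.mem_insert, Finset.mem_singleton] at hx
    rcases hx with rfl | rfl | rfl | rfl <;> simpa
  have hcard : ({i, j, k, l} : Finset ι).card = 4 := by
    rw [Finset.card_insert_of_notMem (by simp [hji.symm, hki.symm, hli.symm]),
      Finset.card_insert_of_notMem (by simp [hkj.symm, hlj.symm]),
      Finset.card_insert_of_notMem (by simp [hlk.symm]), Finset.card_singleton]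
  exact hcard ▸ Finset.card_le_card hsub

theorem card_le_card_vertices_add_finrank_ker (src tgt : ι → V) :
    Fintype.card ι ≤ (Finset.univ.image src ∪ Finset.univ.image tgt).card +
      Module.finrank (ZMod 2) (LinearMap.ker (incidence src tgt)) := by
  classical
  set W := Finset.univ.image src ∪ Finset.univ.image tgt with hW
  let T : Finset (V → ZMod 2) := W.image fun v => Pi.single v 1
  have hrange : LinearMap.range (incidence src tgt) ≤ Submodule.span (ZMod 2) (T : Set _) := by
    rintro _ ⟨z, rfl⟩
    refine Submodule.sum_mem _ fun i _ => Submodule.smul_mem _ _ (Submodule.add_mem _ ?_ ?_) <;>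
    · apply Submodule.subset_span
      simp only [T, Finset.coe_image]
      exact ⟨_, by simp [hW], rfl⟩
  have h1 := LinearMap.finrank_range_add_finrank_ker (incidence src tgt)
  rw [Module.finrank_fintype_fun_eq_card] at h1
  have h2 := Submodule.finrank_mono hrange
  have h3 : Module.finrank (ZMod 2) (Submodule.span (ZMod 2) (T : Set (V → ZMod 2))) ≤ T.card :=
    finrank_span_finset_le_card T
  have h4 : T.card ≤ W.card := Finset.card_image_le
  omega

/-- The counting half of MacLane's planarity criterion, for bipartite graphs: if the cycle space is
spanned by vectors `β q` that come from a dual graph, in which the edge `i` joins the nodes `l i`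
and `r i`, then there are at most twice as many edges as vertices. -/
theorem card_le_of_dual {Q : Type*} [DecidableEq Q] {src tgt : ι → V}
    (hbip : ∀ i j, src i ≠ tgt j) (hinj : ∀ i j, src i = src j → tgt i = tgt j → i = j)
    (l r : ι → Q)
    (hcycle : ∀ q, incidence src tgt
      (fun i => (if l i = q then 1 else 0) + (if r i = q then 1 else 0)) = 0)
    (hspan : ∀ z, incidence src tgt z = 0 → ∃ c : Q → ZMod 2, ∀ i, z i = c (l i) + c (r i)) :
    Fintype.card ι ≤ 2 * (Finset.univ.image src ∪ Finset.univ.image tgt).card := by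
  classical
  let β : Q → ι → ZMod 2 := fun q i => (if l i = q then 1 else 0) + (if r i = q then 1 else 0)
  let I₀ : Finset Q := Finset.univ.image l ∪ Finset.univ.image r
  let I : Finset Q := I₀.filter fun q => β q ≠ 0
  have hker : Module.finrank (ZMod 2) (LinearMap.ker (incidence src tgt)) ≤ I.card := by
    have hle : LinearMap.ker (incidence src tgt) ≤
        Submodule.span (ZMod 2) (I.image β : Set (ι → ZMod 2)) := by
      intro z hz
      obtain ⟨c, hc⟩ := hspan z hz
      have hsum : z = ∑ q ∈ I₀, c q • β q := by
        ext i
        rw [hc i]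
        simp [β, Finset.sum_apply, mul_add, Finset.sum_add_distrib, I₀]
      rw [hsum]
      refine Submodule.sum_mem _ fun q hq => Submodule.smul_mem _ _ ?_
      by_cases hβ : β q = 0
      · rw [hβ]; exact Submodule.zero_mem _
      · apply Submodule.subset_span
        exact Finset.mem_coe.2 (Finset.mem_image_of_mem _ (Finset.mem_filter.2 ⟨hq, hβ⟩))
    calc _ ≤ _ := Submodule.finrank_mono hle
      _ ≤ (I.image β).card := finrank_span_finset_le_card _
      _ ≤ I.card := Finset.card_image_le
  have hcount : 4 * I.card ≤ 2 * Fintype.card ι := by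
    calc 4 * I.card = ∑ q ∈ I, 4 := by rw [Finset.sum_const, smul_eq_mul, mul_comm]
      _ ≤ ∑ q ∈ I, (Finset.univ.filter fun i => β q i ≠ 0).card :=
        Finset.sum_le_sum fun q hq =>
          four_le_card_support hbip hinj (hcycle q) (Finset.mem_filter.1 hq).2
      _ = ∑ i, (I.filter fun q => β q i ≠ 0).card :=
        Finset.sum_card_bipartiteAbove_eq_sum_card_bipartiteBelow fun q i => β q i ≠ 0
      _ ≤ ∑ _i : ι, 2 := Finset.sum_le_sum fun i _ => by
        refine (Finset.card_le_card (t := {l i, r i}) fun q hq => ?_).trans Finset.card_le_two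
        by_contra hq'
        simp only [Finset.mem_insert, Finset.mem_singleton, not_or] at hq'
        exact (Finset.mem_filter.1 hq).2 (by simp [β, Ne.symm hq'.1, Ne.symm hq'.2])
      _ = 2 * Fintype.card ι := by simp [mul_comm]
  have := card_le_card_vertices_add_finrank_ker src tgt
  omega

end Incidence

section GridMinor

variable {V ι : Type*} [Fintype ι] [DecidableEq V] {B : V → Set (ℤ × ℤ)} {src tgt : ι → V}
  {ρ : ι → (ℤ × ℤ) × Bool}

theorem gridBoundary_eq_sum_single (z : (ℤ × ℤ) × Bool → ZMod 2) {T : Finset ((ℤ × ℤ) × Bool)}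
    {p : ℤ × ℤ} (hT : ∀ ε, ε.1 = p ∨ gridNext ε = p → ε ∈ T) :
    gridBoundary z p = ∑ ε ∈ T, ((if p = ε.1 then z ε else 0) +
      if p = gridNext ε then z ε else 0) := by
  have h1 : gridBoundary z p = gridBoundary (∑ ε ∈ T, Pi.single ε (z ε)) p := by
    have h : ∀ ε, ε.1 = p ∨ gridNext ε = p → z ε = (∑ ε ∈ T, Pi.single ε (z ε) : _ → ZMod 2) ε := by
      intro ε hε
      rw [Finset.sum_apply, Finset.sum_pi_single, if_pos (hT ε hε)]
    simp only [gridBoundary_apply]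
    rw [← h (p, true) (Or.inl rfl), ← h (_, true) (Or.inr (by simp [gridNext])),
      ← h (p, false) (Or.inl rfl), ← h (_, false) (Or.inr (by simp [gridNext]))]
  rw [h1, map_sum, Finset.sum_apply]
  refine Finset.sum_congr rfl fun ε _ => ?_
  rw [gridBoundary_single, Pi.add_apply, Pi.single_apply, Pi.single_apply]

/-- A grid cycle supported on the edges inside the branch sets and on the edges `ρ i` joining them
restricts to a cycle of the minor. -/
theorem incidence_eq_zero_of_gridBoundary (h : IsGridMinor B src tgt)
    (hρinj : Function.Injective ρ)
    (hρ : ∀ i, ((ρ i).1 ∈ B (src i) ∧ gridNext (ρ i) ∈ B (tgt i)) ∨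
      ((ρ i).1 ∈ B (tgt i) ∧ gridNext (ρ i) ∈ B (src i)))
    {z : (ℤ × ℤ) × Bool → ZMod 2} (hz : gridBoundary z = 0)
    (hsupp : ∀ ε, z ε ≠ 0 → (∃ v, ε.1 ∈ B v ∧ gridNext ε ∈ B v) ∨ ε ∈ Set.range ρ) :
    incidence src tgt (fun i => z (ρ i)) = 0 := by
  classical
  ext v
  let S : Finset (ℤ × ℤ) := (h.finite v).toFinset
  have hS : ∀ p, p ∈ S ↔ p ∈ B v := fun p => Set.Finite.mem_toFinset _
  let T : Finset ((ℤ × ℤ) × Bool) := S ×ˢ Finset.univ ∪ S.image (fun p => ((p.1 - 1, p.2), true)) ∪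
    S.image (fun p => ((p.1, p.2 - 1), false)) ∪ Finset.univ.image ρ
  have hT : ∀ p ∈ S, ∀ ε, ε.1 = p ∨ gridNext ε = p → ε ∈ T := by
    rintro p hp ⟨⟨i, j⟩, b⟩ hε
    rcases hε with rfl | rfl
    · simp [T, hp]
    · cases b
      · simp only [T, Finset.mem_union, Finset.mem_image]
        exact Or.inl (Or.inr ⟨_, hp, by simp [gridNext]⟩)
      · simp only [T, Finset.mem_union, Finset.mem_image]
        exact Or.inl (Or.inl (Or.inr ⟨_, hp, by simp [gridNext]⟩))
  have hmem : ∀ w p, p ∈ B w → (p ∈ S ↔ v = w) := fun w p hp =>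
    (hS p).trans ⟨fun hv => h.disjoint v w p hv hp, by rintro rfl; exact hp⟩
  have key : ∑ ε ∈ T, ((if ε.1 ∈ S then z ε else 0) + if gridNext ε ∈ S then z ε else 0) = 0 := by
    have h0 : ∑ p ∈ S, gridBoundary z p = 0 := by simp [hz]
    rw [Finset.sum_congr rfl fun p hp => gridBoundary_eq_sum_single z (hT p hp),
      Finset.sum_comm] at h0
    simpa [Finset.sum_add_distrib] using h0
  rw [incidence_apply]
  refine Eq.trans ?_ key
  rw [← Finset.sum_subset (s₁ := Finset.univ.image ρ) Finset.subset_union_right,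
    Finset.sum_image hρinj.injOn]
  · refine Finset.sum_congr rfl fun i _ => ?_
    rcases hρ i with ⟨h1, h2⟩ | ⟨h1, h2⟩ <;> simp only [hmem _ _ h1, hmem _ _ h2] <;>
      split_ifs <;> ring
  · intro ε _ hε
    by_cases hzε : z ε = 0
    · simp [hzε]
    · rcases hsupp ε hzε with ⟨w, h1, h2⟩ | ⟨i, rfl⟩
      · simp only [hmem _ _ h1, hmem _ _ h2]
        split_ifs
        · exact CharTwo.add_self_eq_zero _
        · exact add_zero 0
      · simp at hε

/-- A cycle of the minor lifts to a cycle of the grid. -/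
theorem exists_gridBoundary_lift (h : IsGridMinor B src tgt) (hbip : ∀ i j, src i ≠ tgt j)
    (hρinj : Function.Injective ρ)
    (hρ : ∀ i, ((ρ i).1 ∈ B (src i) ∧ gridNext (ρ i) ∈ B (tgt i)) ∨
      ((ρ i).1 ∈ B (tgt i) ∧ gridNext (ρ i) ∈ B (src i)))
    {z : ι → ZMod 2} (hz : incidence src tgt z = 0) :
    ∃ y : (ℤ × ℤ) × Bool → ZMod 2, gridBoundary y = 0 ∧ (∀ i, y (ρ i) = z i) ∧
      ∀ ε, y ε ≠ 0 → (∃ v, ε.1 ∈ B v ∧ gridNext ε ∈ B v) ∨ ε ∈ Set.range ρ := by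
  classical
  choose base hbase using h.nonempty
  have hchain : ∀ v, ∀ p ∈ B v, ∃ J : (ℤ × ℤ) × Bool → ZMod 2,
      (∀ ε, J ε ≠ 0 → ε.1 ∈ B v ∧ gridNext ε ∈ B v) ∧
      gridBoundary J = Pi.single p 1 + Pi.single (base v) 1 :=
    fun v p hp => exists_chain_of_path (h.connected v p hp _ (hbase v))
  have hR : ∀ i, ∃ J : (ℤ × ℤ) × Bool → ZMod 2,
      (∀ ε, J ε ≠ 0 → ∃ v, ε.1 ∈ B v ∧ gridNext ε ∈ B v) ∧
      gridBoundary (Pi.single (ρ i) 1 + J) =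
        Pi.single (base (src i)) 1 + Pi.single (base (tgt i)) 1 := by
    intro i
    have aux : ∀ u v, (ρ i).1 ∈ B u → gridNext (ρ i) ∈ B v →
        ∃ J : (ℤ × ℤ) × Bool → ZMod 2, (∀ ε, J ε ≠ 0 → ∃ v, ε.1 ∈ B v ∧ gridNext ε ∈ B v) ∧
          gridBoundary (Pi.single (ρ i) 1 + J) = Pi.single (base u) 1 + Pi.single (base v) 1 := by
      intro u v hu hv
      obtain ⟨J, hJ, hJb⟩ := hchain u _ hu
      obtain ⟨J', hJ', hJb'⟩ := hchain v _ hv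
      refine ⟨J + J', fun ε hε => ?_, ?_⟩
      · by_cases h0 : J ε = 0
        · exact ⟨v, hJ' ε (by simpa [h0] using hε)⟩
        · exact ⟨u, hJ ε h0⟩
      · rw [map_add, map_add, gridBoundary_single, hJb, hJb']
        linear_combination CharTwo.add_self_eq_zero (Pi.single (ρ i).1 1 : ℤ × ℤ → ZMod 2) +
          CharTwo.add_self_eq_zero (Pi.single (gridNext (ρ i)) 1 : ℤ × ℤ → ZMod 2)
    rcases hρ i with ⟨h1, h2⟩ | ⟨h1, h2⟩
    · exact aux _ _ h1 h2
    · rw [add_comm (Pi.single (base (src i)) 1)]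
      exact aux _ _ h1 h2
  choose J hJ hJb using hR
  have hJρ : ∀ i j, J i (ρ j) = 0 := by
    intro i j
    by_contra hne
    obtain ⟨v, h1, h2⟩ := hJ i _ hne
    rcases hρ j with ⟨h3, h4⟩ | ⟨h3, h4⟩
    · exact hbip j j ((h.disjoint _ _ _ h3 h1).trans (h.disjoint _ _ _ h2 h4))
    · exact hbip j j ((h.disjoint _ _ _ h4 h2).trans (h.disjoint _ _ _ h1 h3))
  refine ⟨∑ i, z i • (Pi.single (ρ i) 1 + J i), ?_, fun j => ?_, fun ε hε => ?_⟩
  · ext p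
    simp only [map_sum, map_smul, hJb]
    have hinjb : Function.Injective base := fun u v huv =>
      h.disjoint _ _ _ (hbase u) (huv ▸ hbase v)
    by_cases hp : p ∈ Set.range base
    · obtain ⟨v, rfl⟩ := hp
      have := congrFun hz v
      rw [incidence_apply] at this
      simpa [Finset.sum_apply, Pi.single_apply, hinjb.eq_iff, mul_add] using this
    · have hp' : ∀ v, p ≠ base v := fun v hv => hp ⟨v, hv.symm⟩
      simp [Finset.sum_apply, hp']
  · simp [Finset.sum_apply, hJρ, Pi.single_apply, hρinj.eq_iff]
  · rw [Finset.sum_apply] at hε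
    obtain ⟨i, -, hi⟩ := Finset.exists_ne_zero_of_sum_ne_zero hε
    by_cases hεi : ε = ρ i
    · exact Or.inr ⟨i, hεi.symm⟩
    · refine Or.inl (hJ i ε fun h0 => hi ?_)
      simp [h0, hεi]

/-- A simple bipartite minor of the square grid has at most twice as many edges as vertices. -/
theorem IsGridMinor.card_le (h : IsGridMinor B src tgt) (hbip : ∀ i j, src i ≠ tgt j)
    (hinj : ∀ i j, src i = src j → tgt i = tgt j → i = j) :
    Fintype.card ι ≤ 2 * (Finset.univ.image src ∪ Finset.univ.image tgt).card := by
  classical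
  choose ρ hρ using h.edge
  have hρinj : Function.Injective ρ := by
    intro i j hij
    rcases hρ i with ⟨h1, h2⟩ | ⟨h1, h2⟩ <;> rcases hρ j with ⟨h3, h4⟩ | ⟨h3, h4⟩ <;>
      rw [hij] at h1 h2
    · exact hinj _ _ (h.disjoint _ _ _ h1 h3) (h.disjoint _ _ _ h2 h4)
    · exact absurd (h.disjoint _ _ _ h1 h3) (hbip _ _)
    · exact absurd (h.disjoint _ _ _ h3 h1) (hbip _ _)
    · exact hinj _ _ (h.disjoint _ _ _ h2 h4) (h.disjoint _ _ _ h1 h3)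
  let K : (ℤ × ℤ) × Bool → Prop := fun ε =>
    (∃ v, ε.1 ∈ B v ∧ gridNext ε ∈ B v) ∨ ε ∈ Set.range ρ
  let R : ℤ × ℤ → ℤ × ℤ → Prop := fun s t => ∃ ε, ¬ K ε ∧ s = ε.1 ∧ t = gridBack ε
  refine card_le_of_dual (Q := Quot R) hbip hinj (fun i => Quot.mk R (ρ i).1)
    (fun i => Quot.mk R (gridBack (ρ i))) (fun q => ?_) (fun z hz => ?_)
  · refine incidence_eq_zero_of_gridBoundary h hρinj hρ
      (gridBoundary_gridJump fun s => if Quot.mk R s = q then 1 else 0) fun ε hε => ?_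
    by_contra hK
    refine hε ?_
    have : Quot.mk R ε.1 = Quot.mk R (gridBack ε) := Quot.sound ⟨ε, hK, rfl, rfl⟩
    simp only [gridJump, this]
    exact CharTwo.add_self_eq_zero _
  · obtain ⟨y, hy, hyρ, hyK⟩ := exists_gridBoundary_lift h hbip hρinj hρ hz
    obtain ⟨c, rfl⟩ := exists_gridJump_eq hy
    refine ⟨Quot.lift c ?_, fun i => (hyρ i).symm⟩
    rintro _ _ ⟨ε, hK, rfl, rfl⟩
    by_contra hne
    exact hK (hyK ε fun h0 => hne (CharTwo.add_eq_zero.mp h0))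

end GridMinor

section Discretization

open Relation (ReflTransGen)

theorem gridPath_symm {S : Set (ℤ × ℤ)} {p q : ℤ × ℤ} (h : ReflTransGen (GridStep S) p q) :
    ReflTransGen (GridStep S) q p := by
  induction h with
  | refl => exact .refl
  | tail _ hs ih => exact .head (gridStep_symm hs) ih

theorem gridPath_mono {S T : Set (ℤ × ℤ)} (hST : S ⊆ T) {p q : ℤ × ℤ}
    (h : ReflTransGen (GridStep S) p q) : ReflTransGen (GridStep T) p q :=
  ReflTransGen.mono (r := GridStep S) (p := GridStep T)
    (fun _ _ hs => ⟨hST hs.1, hST hs.2.1, hs.2.2⟩) _ _ h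

theorem gridPath_row {S : Set (ℤ × ℤ)} {i i' j : ℤ} (h : ∀ k ∈ Set.uIcc i i', (k, j) ∈ S) :
    ReflTransGen (GridStep S) (i, j) (i', j) := by
  wlog hle : i ≤ i' generalizing i i'
  · exact gridPath_symm (this (by rwa [Set.uIcc_comm]) (le_of_not_ge hle))
  rw [Set.uIcc_of_le hle] at h
  induction i', hle using Int.leInduction with
  | base => exact .refl
  | succ n hn ih =>
    exact (ih fun k hk => h k ⟨hk.1, by linarith [hk.2]⟩).tail
      ⟨h n ⟨hn, by omega⟩, h _ ⟨by omega, le_rfl⟩, true, Or.inl rfl⟩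

theorem gridPath_column {S : Set (ℤ × ℤ)} {i j j' : ℤ} (h : ∀ k ∈ Set.uIcc j j', (i, k) ∈ S) :
    ReflTransGen (GridStep S) (i, j) (i, j') := by
  wlog hle : j ≤ j' generalizing j j'
  · exact gridPath_symm (this (by rwa [Set.uIcc_comm]) (le_of_not_ge hle))
  rw [Set.uIcc_of_le hle] at h
  induction j', hle using Int.leInduction with
  | base => exact .refl
  | succ n hn ih =>
    exact (ih fun k hk => h k ⟨hk.1, by linarith [hk.2]⟩).tail
      ⟨h n ⟨hn, by omega⟩, h _ ⟨by omega, le_rfl⟩, false, Or.inl rfl⟩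

theorem gridPath_prod {X Y : Set ℤ} [X.OrdConnected] [Y.OrdConnected] {p q : ℤ × ℤ}
    (hp : p ∈ X ×ˢ Y) (hq : q ∈ X ×ˢ Y) : ReflTransGen (GridStep (X ×ˢ Y)) p q :=
  (gridPath_row (i' := q.1) fun _ hk =>
    Set.mk_mem_prod (Set.OrdConnected.uIcc_subset ‹_› hp.1 hq.1 hk) hp.2).trans
      (gridPath_column fun _ hk =>
        Set.mk_mem_prod hq.1 (Set.OrdConnected.uIcc_subset ‹_› hp.2 hq.2 hk))

/-- The point of the plane named by a point of the grid with mesh `δ`. -/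
def meshPoint (δ : ℝ) (p : ℤ × ℤ) : ℝ × ℝ := (δ * p.1, δ * p.2)

/-- The grid point at the lower left of a point of the plane. -/
noncomputable def meshFloor (δ : ℝ) (x : ℝ × ℝ) : ℤ × ℤ := (⌊x.1 / δ⌋, ⌊x.2 / δ⌋)

/-- The grid points close to a subset of the plane. -/
def meshNear (δ : ℝ) (K : Set (ℝ × ℝ)) : Set (ℤ × ℤ) :=
  {p | ∃ x ∈ K, dist (meshPoint δ p) x ≤ 2 * δ}

/-- The grid points in a closed ball (for the supremum norm). -/
def meshBall (δ : ℝ) (c : ℝ × ℝ) (r : ℝ) : Set (ℤ × ℤ) := {p | dist (meshPoint δ p) c ≤ r}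

variable {δ : ℝ}

theorem abs_mul_floor_sub_le (hδ : 0 < δ) (a : ℝ) : |δ * ⌊a / δ⌋ - a| ≤ δ := by
  have h1 : δ * (⌊a / δ⌋ : ℝ) ≤ a := by
    have := mul_le_mul_of_nonneg_left (Int.floor_le (a / δ)) hδ.le
    rwa [mul_div_cancel₀ _ hδ.ne'] at this
  have h2 : a ≤ δ * (⌊a / δ⌋ + 1 : ℝ) := by
    have := mul_le_mul_of_nonneg_left (Int.lt_floor_add_one (a / δ)).le hδ.le
    rwa [mul_div_cancel₀ _ hδ.ne'] at this
  rw [abs_le]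
  constructor <;> linarith

theorem floor_sub_one_le (hδ : 0 < δ) {a b : ℝ} (hab : |a - b| < δ) :
    ⌊a / δ⌋ ≤ ⌊b / δ⌋ + 1 := by
  have h : a / δ ≤ b / δ + 1 := by
    rw [div_add_one hδ.ne', div_le_div_iff_of_pos_right hδ]
    linarith [(abs_lt.mp hab).2]
  simpa using Int.floor_mono h

theorem dist_meshPoint_meshFloor_le (hδ : 0 < δ) (x : ℝ × ℝ) :
    dist (meshPoint δ (meshFloor δ x)) x ≤ δ :=
  max_le (abs_mul_floor_sub_le hδ _) (abs_mul_floor_sub_le hδ _)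

theorem meshFloor_mem_meshNear (hδ : 0 < δ) {K : Set (ℝ × ℝ)} {x : ℝ × ℝ} (hx : x ∈ K) :
    meshFloor δ x ∈ meshNear δ K :=
  ⟨x, hx, (dist_meshPoint_meshFloor_le hδ x).trans (by linarith)⟩

theorem gridPath_meshNear_of_dist_lt (hδ : 0 < δ) {K : Set (ℝ × ℝ)} {x y : ℝ × ℝ} (hx : x ∈ K)
    (hy : y ∈ K) (hxy : dist x y < δ) :
    ReflTransGen (GridStep (meshNear δ K)) (meshFloor δ x) (meshFloor δ y) := by
  have hd : |x.1 - y.1| < δ ∧ |x.2 - y.2| < δ := max_lt_iff.mp hxy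
  have h1 := floor_sub_one_le hδ hd.1
  have h1' := floor_sub_one_le hδ (abs_sub_comm x.1 y.1 ▸ hd.1)
  have h2 := floor_sub_one_le hδ hd.2
  have h2' := floor_sub_one_le hδ (abs_sub_comm x.2 y.2 ▸ hd.2)
  have hcorner : (⌊y.1 / δ⌋, ⌊x.2 / δ⌋) ∈ meshNear δ K := by
    refine ⟨x, hx, max_le ?_ ((abs_mul_floor_sub_le hδ _).trans (by linarith))⟩
    calc |δ * ⌊y.1 / δ⌋ - x.1| ≤ |δ * ⌊y.1 / δ⌋ - y.1| + |y.1 - x.1| := abs_sub_le _ _ _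
      _ ≤ δ + δ := add_le_add (abs_mul_floor_sub_le hδ _) (abs_sub_comm x.1 y.1 ▸ hd.1.le)
      _ = 2 * δ := (two_mul δ).symm
  refine (gridPath_row (i' := ⌊y.1 / δ⌋) fun k hk => ?_).trans (gridPath_column fun k hk => ?_)
  · rw [Set.mem_uIcc] at hk
    obtain rfl | rfl : k = ⌊x.1 / δ⌋ ∨ k = ⌊y.1 / δ⌋ := by omega
    · exact meshFloor_mem_meshNear hδ hx
    · exact hcorner
  · rw [Set.mem_uIcc] at hk
    obtain rfl | rfl : k = ⌊x.2 / δ⌋ ∨ k = ⌊y.2 / δ⌋ := by omega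
    · exact hcorner
    · exact meshFloor_mem_meshNear hδ hy

theorem gridPath_meshNear (hδ : 0 < δ) {K : Set (ℝ × ℝ)} (hK : IsPreconnected K) {x y : ℝ × ℝ}
    (hx : x ∈ K) (hy : y ∈ K) :
    ReflTransGen (GridStep (meshNear δ K)) (meshFloor δ x) (meshFloor δ y) := by
  refine hK.induction₂
    (fun x y => ReflTransGen (GridStep (meshNear δ K)) (meshFloor δ x) (meshFloor δ y))
    (fun x hx => ?_) (fun _ _ _ _ _ _ h h' => h.trans h') (fun _ _ _ _ h => gridPath_symm h) hx hy
  filter_upwards [self_mem_nhdsWithin, mem_nhdsWithin_of_mem_nhds (Metric.ball_mem_nhds x hδ)]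
    with y hy hxy
  exact gridPath_meshNear_of_dist_lt hδ hx hy (by rwa [dist_comm])

theorem meshBall_eq_prod (c : ℝ × ℝ) (r : ℝ) :
    meshBall δ c r = {i : ℤ | |δ * i - c.1| ≤ r} ×ˢ {j : ℤ | |δ * j - c.2| ≤ r} := by
  ext p
  exact max_le_iff (a := |δ * p.1 - c.1|)

theorem ordConnected_mesh (hδ : 0 < δ) (a r : ℝ) : {i : ℤ | |δ * i - a| ≤ r}.OrdConnected := by
  refine ⟨fun i hi j hj k hk => ?_⟩
  simp only [Set.mem_ofPred_eq, abs_le] at hi hj ⊢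
  have h1 : δ * (i : ℝ) ≤ δ * k := mul_le_mul_of_nonneg_left (by exact_mod_cast hk.1) hδ.le
  have h2 : δ * (k : ℝ) ≤ δ * j := mul_le_mul_of_nonneg_left (by exact_mod_cast hk.2) hδ.le
  constructor <;> linarith

theorem finite_mesh (hδ : 0 < δ) (a r : ℝ) : {i : ℤ | |δ * i - a| ≤ r}.Finite := by
  refine (Set.finite_Icc ⌈(a - r) / δ⌉ ⌊(a + r) / δ⌋).subset fun i hi => ?_
  rw [Set.mem_ofPred_eq, abs_le] at hi
  rw [Set.mem_Icc, Int.ceil_le, Int.le_floor, div_le_iff₀ hδ, le_div_iff₀ hδ]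
  constructor <;> linarith

theorem gridPath_meshBall (hδ : 0 < δ) {c : ℝ × ℝ} {r : ℝ} {p q : ℤ × ℤ} (hp : p ∈ meshBall δ c r)
    (hq : q ∈ meshBall δ c r) : ReflTransGen (GridStep (meshBall δ c r)) p q := by
  rw [meshBall_eq_prod] at *
  have := ordConnected_mesh hδ c.1 r
  have := ordConnected_mesh hδ c.2 r
  exact gridPath_prod hp hq

theorem finite_meshBall (hδ : 0 < δ) (c : ℝ × ℝ) (r : ℝ) : (meshBall δ c r).Finite := by
  rw [meshBall_eq_prod]
  exact (finite_mesh hδ _ _).prod (finite_mesh hδ _ _)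

theorem finite_meshNear (hδ : 0 < δ) {K : Set (ℝ × ℝ)} (hK : Bornology.IsBounded K) :
    (meshNear δ K).Finite := by
  obtain ⟨R, hR⟩ := hK.subset_closedBall 0
  refine (finite_meshBall hδ 0 (2 * δ + R)).subset ?_
  rintro p ⟨x, hx, hpx⟩
  exact (dist_triangle _ x _).trans (add_le_add hpx (hR hx))

theorem IsCompact.eventually_lt_dist {X : Type*} [PseudoMetricSpace X] {K C : Set X}
    (hK : IsCompact K) (hC : IsClosed C) (hKC : Disjoint K C) :
    ∀ᶠ ε : ℝ in nhdsWithin 0 (Set.Ioi 0), ∀ x ∈ K, ∀ y ∈ C, ε < dist x y := by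
  obtain ⟨r, hr, h⟩ := Metric.exists_pos_forall_lt_edist hK hC hKC
  filter_upwards [Ioo_mem_nhdsGT (show (0 : ℝ) < r from hr)] with ε hε x hx y hy
  have := h x hx y hy
  rw [edist_nndist, ENNReal.coe_lt_coe] at this
  exact hε.2.trans (by exact_mod_cast this)

end Discretization

section Planar

open Relation (ReflTransGen)

variable {V ι : Type*} {src tgt : ι → V}

/-- A grid minor obtained from disjoint finite sets `S v` with connected cores `A v`, and for each
edge a grid path from core to core that stays in `S (src i)` until it enters `A (tgt i)`. -/
theorem exists_isGridMinor_of_cores {S A : V → Set (ℤ × ℤ)} {D : ι → Set (ℤ × ℤ)}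
    (hne : ∀ i, src i ≠ tgt i) (hfin : ∀ v, (S v).Finite)
    (hdisj : ∀ u v p, p ∈ S u → p ∈ S v → u = v) (hAS : ∀ v, A v ⊆ S v)
    (hAne : ∀ v, (A v).Nonempty)
    (hA : ∀ v, ∀ p ∈ A v, ∀ q ∈ A v, ReflTransGen (GridStep (A v)) p q)
    (hD : ∀ i, D i ⊆ S (src i) ∪ A (tgt i))
    (hpath : ∀ i, ∃ p ∈ A (src i), ∃ q ∈ A (tgt i), ReflTransGen (GridStep (D i)) p q) :
    ∃ B, IsGridMinor B src tgt := by
  choose base hbase using hAne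
  let B : V → Set (ℤ × ℤ) := fun v => {p | ReflTransGen (GridStep (S v)) (base v) p}
  have hBS : ∀ v, B v ⊆ S v := by
    intro v p hp
    rcases ReflTransGen.cases_tail hp with rfl | ⟨q, _, hq⟩
    · exact hAS v (hbase v)
    · exact hq.2.1
  have hAB : ∀ v, A v ⊆ B v := fun v p hp => gridPath_mono (hAS v) (hA v _ (hbase v) _ hp)
  have hconn : ∀ v p, p ∈ B v → ReflTransGen (GridStep (B v)) (base v) p := by
    intro v p hp
    induction hp with
    | refl => exact .refl
    | tail hq hs ih => exact ih.tail ⟨hq, hq.tail hs, hs.2.2⟩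
  refine ⟨B, fun v => (hfin v).subset (hBS v), fun v => ⟨_, hAB v (hbase v)⟩,
    fun u v p hu hv => hdisj u v p (hBS u hu) (hBS v hv),
    fun v p hp q hq => (gridPath_symm (hconn v p hp)).trans (hconn v q hq), fun i => ?_⟩
  by_contra hno
  obtain ⟨p, hp, q, hq, hpq⟩ := hpath i
  have hq' : q ∈ B (src i) := by
    clear hq
    induction hpq with
    | refl => exact hAB _ hp
    | @tail x y _ hs ih =>
      rcases hD i hs.2.1 with hy | hy
      · exact ReflTransGen.tail ih ⟨hBS _ ih, hy, hs.2.2⟩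
      · obtain ⟨b, rfl | rfl⟩ := hs.2.2
        · exact absurd ⟨_, Or.inl ⟨ih, hAB _ hy⟩⟩ hno
        · exact absurd ⟨_, Or.inr ⟨hAB _ hy, ih⟩⟩ hno
  exact hne i (hdisj _ _ q (hBS _ hq') (hAS _ hq))

/-- A graph drawn in the plane with compact connected edges that meet only at common ends is a
minor of the square grid. -/
theorem exists_isGridMinor_of_drawing [Finite V] [Finite ι] {pos : V → ℝ × ℝ}
    {D : ι → Set (ℝ × ℝ)} (hne : ∀ i, src i ≠ tgt i) (hpos : Function.Injective pos)
    (hcomp : ∀ i, IsCompact (D i)) (hconn : ∀ i, IsPreconnected (D i))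
    (hsrc : ∀ i, pos (src i) ∈ D i) (htgt : ∀ i, pos (tgt i) ∈ D i)
    (hends : ∀ i v, pos v ∈ D i → v = src i ∨ v = tgt i)
    (hcross : ∀ i j, i ≠ j → ∀ x, x ∈ D i → x ∈ D j → x ∈ Set.range pos) :
    ∃ B, IsGridMinor B src tgt := by
  obtain ⟨r, hr, hrV, hrD⟩ : ∃ r : ℝ, 0 < r ∧ (∀ u v, u ≠ v → 2 * r < dist (pos u) (pos v)) ∧
      ∀ i v, v ≠ src i → v ≠ tgt i → ∀ x ∈ D i, 2 * r < dist x (pos v) := by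
    have h1 : ∀ᶠ ε : ℝ in nhdsWithin 0 (Set.Ioi 0), ∀ u v, u ≠ v → ε < dist (pos u) (pos v) := by
      refine Filter.eventually_all.2 fun u => Filter.eventually_all.2 fun v => ?_
      by_cases huv : u = v
      · simp [huv]
      · filter_upwards [Ioo_mem_nhdsGT (dist_pos.2 (hpos.ne huv))] with ε hε _ using hε.2
    have h2 : ∀ᶠ ε : ℝ in nhdsWithin 0 (Set.Ioi 0), ∀ i v, v ≠ src i → v ≠ tgt i →
        ∀ x ∈ D i, ε < dist x (pos v) := by
      refine Filter.eventually_all.2 fun i => Filter.eventually_all.2 fun v => ?_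
      by_cases hv : pos v ∈ D i
      · have := hends i v hv
        exact Filter.Eventually.of_forall fun ε h h' => by tauto
      · filter_upwards [(hcomp i).eventually_lt_dist (isClosed_singleton (x := pos v))
          (by simpa using hv)] with ε hε _ _ x hx using hε x hx _ rfl
    obtain ⟨ε, ⟨h1, h2⟩, hε⟩ := ((h1.and h2).and self_mem_nhdsWithin).exists
    exact ⟨ε / 2, by positivity, by simpa [mul_div_cancel₀] using h1,
      by simpa [mul_div_cancel₀] using h2⟩
  obtain ⟨δ, hδ, hδr, hδD⟩ : ∃ δ : ℝ, 0 < δ ∧ 4 * δ < r ∧ ∀ i j, i ≠ j → ∀ x ∈ D i, ∀ y ∈ D j,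
      (∀ v, r / 2 ≤ dist x (pos v)) → 4 * δ < dist x y := by
    have h1 : ∀ᶠ ε : ℝ in nhdsWithin 0 (Set.Ioi 0), ∀ i j, i ≠ j → ∀ x ∈ D i, ∀ y ∈ D j,
        (∀ v, r / 2 ≤ dist x (pos v)) → ε < dist x y := by
      refine Filter.eventually_all.2 fun i => Filter.eventually_all.2 fun j => ?_
      by_cases hij : i = j
      · simp [hij]
      · have hK : IsCompact (D i \ ⋃ v, Metric.ball (pos v) (r / 2)) :=
          (hcomp i).diff (isOpen_iUnion fun v => Metric.isOpen_ball)
        have hdisj : Disjoint (D i \ ⋃ v, Metric.ball (pos v) (r / 2)) (D j) := by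
          rw [Set.disjoint_left]
          rintro x ⟨hxi, hx⟩ hxj
          obtain ⟨v, rfl⟩ := hcross i j hij x hxi hxj
          exact hx (Set.mem_iUnion.2 ⟨v, Metric.mem_ball_self (by positivity)⟩)
        filter_upwards [hK.eventually_lt_dist (hcomp j).isClosed hdisj] with ε hε _ x hx y hy hxv
        refine hε x ⟨hx, fun hmem => ?_⟩ y hy
        obtain ⟨v, hv⟩ := Set.mem_iUnion.1 hmem
        exact (hxv v).not_gt hv
    obtain ⟨ε, ⟨h1, h2⟩, hε⟩ :=
      ((h1.and (Ioo_mem_nhdsGT hr)).and self_mem_nhdsWithin).exists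
    exact ⟨ε / 4, by positivity, by linarith [h2.2], by simpa [mul_div_cancel₀] using h1⟩
  let A : V → Set (ℤ × ℤ) := fun v => meshBall δ (pos v) r
  let S : V → Set (ℤ × ℤ) := fun u =>
    A u ∪ ⋃ i ∈ {i | src i = u}, (meshNear δ (D i) \ ⋃ v, A v)
  have hAA : ∀ u v p, p ∈ A u → p ∈ A v → u = v := by
    intro u v p hu hv
    by_contra huv
    have hu' : dist (meshPoint δ p) (pos u) ≤ r := hu
    have hv' : dist (meshPoint δ p) (pos v) ≤ r := hv
    linarith [hrV u v huv, dist_triangle_left (pos u) (pos v) (meshPoint δ p)]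
  have hfloor : ∀ v, meshFloor δ (pos v) ∈ A v := fun v =>
    (dist_meshPoint_meshFloor_le hδ _).trans (by linarith)
  refine exists_isGridMinor_of_cores (S := S) (A := A) (D := fun i => meshNear δ (D i)) hne
    (fun u => ?_) (fun u v p hu hv => ?_) (fun u => Set.subset_union_left)
    (fun v => ⟨_, hfloor v⟩) (fun v p hp q hq => gridPath_meshBall hδ hp hq) (fun i p hp => ?_)
    (fun i => ⟨_, hfloor _, _, hfloor _, gridPath_meshNear hδ (hconn i) (hsrc i) (htgt i)⟩)
  · exact (finite_meshBall hδ _ _).union ((Set.toFinite _).biUnion fun i _ =>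
      (finite_meshNear hδ (hcomp i).isBounded).sdiff)
  · simp only [S, Set.mem_union, Set.mem_iUnion, Set.mem_sdiff, Set.mem_ofPred_eq] at hu hv
    rcases hu with hu | ⟨i, rfl, hi, hiA⟩ <;> rcases hv with hv | ⟨j, rfl, hj, hjA⟩
    · exact hAA u v p hu hv
    · exact absurd ⟨u, hu⟩ hjA
    · exact absurd ⟨v, hv⟩ hiA
    · by_contra hij
      obtain ⟨x, hx, hpx⟩ := hi
      obtain ⟨y, hy, hpy⟩ := hj
      have hfar : ∀ v, r / 2 ≤ dist x (pos v) := by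
        intro v
        have hv : r < dist (meshPoint δ p) (pos v) := not_le.1 fun hle => hiA ⟨v, hle⟩
        linarith [dist_triangle (meshPoint δ p) x (pos v)]
      have := hδD i j (fun h => hij (h ▸ rfl)) x hx y hy hfar
      linarith [dist_triangle_left x y (meshPoint δ p)]
  · by_cases hpA : p ∈ ⋃ v, A v
    · obtain ⟨v, hv⟩ := Set.mem_iUnion.1 hpA
      by_cases h1 : v = src i
      · subst h1; exact Or.inl (Or.inl hv)
      by_cases h2 : v = tgt i
      · subst h2; exact Or.inr hv
      obtain ⟨x, hx, hpx⟩ := hp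
      have hv' : dist (meshPoint δ p) (pos v) ≤ r := hv
      linarith [hrD i v h1 h2 x hx, dist_triangle_left x (pos v) (meshPoint δ p)]
    · exact Or.inl (Or.inr (Set.mem_biUnion (show src i = src i from rfl) ⟨hp, hpA⟩))

theorem PlanarEmbedding.exists_isGridMinor [Finite V] [Finite ι] {G : SimpleGraph V}
    (H : PlanarEmbedding G) (hadj : ∀ i, G.Adj (src i) (tgt i))
    (hinj : Function.Injective fun i => s(src i, tgt i)) : ∃ B, IsGridMinor B src tgt := by
  have hmem : ∀ i, s(src i, tgt i) ∈ G.edgeSet := fun i => hadj i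
  have hends : ∀ i, H.arc s(src i, tgt i) '' {0, 1} = H.vpos '' {v | v = src i ∨ v = tgt i} := by
    intro i
    rw [H.arc_ends _ (hmem i)]
    simp only [Sym2.mem_iff]
  have hsub : ∀ i v, v = src i ∨ v = tgt i →
      H.vpos v ∈ H.arc s(src i, tgt i) '' Set.Icc 0 1 := by
    intro i v hv
    refine Set.image_mono ?_ ((hends i).symm ▸ Set.mem_image_of_mem H.vpos hv)
    rintro t (rfl | rfl) <;> simp
  have hsplit : ∀ i, ∀ x ∈ H.arc s(src i, tgt i) '' Set.Icc 0 1,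
      x ∈ H.arc s(src i, tgt i) '' Set.Ioo 0 1 ∨ ∃ v, (v = src i ∨ v = tgt i) ∧ H.vpos v = x := by
    rintro i _ ⟨t, ht, rfl⟩
    by_cases h : t ∈ ({0, 1} : Set ℝ)
    · exact Or.inr ((hends i).subset (Set.mem_image_of_mem _ h))
    · simp only [Set.mem_insert_iff, Set.mem_singleton_iff, not_or] at h
      exact Or.inl ⟨t, ⟨lt_of_le_of_ne ht.1 (Ne.symm h.1), lt_of_le_of_ne ht.2 h.2⟩, rfl⟩
  refine exists_isGridMinor_of_drawing (pos := H.vpos)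
    (D := fun i => H.arc s(src i, tgt i) '' Set.Icc 0 1) (fun i => (hadj i).ne) H.vpos_inj
    (fun i => isCompact_Icc.image_of_continuousOn (H.arc_cont _ (hmem i)))
    (fun i => isPreconnected_Icc.image _ (H.arc_cont _ (hmem i)))
    (fun i => hsub i _ (Or.inl rfl)) (fun i => hsub i _ (Or.inr rfl)) (fun i v hv => ?_)
    (fun i j hij x hi hj => ?_)
  · rcases hsplit i _ hv with h | ⟨w, hw, hwv⟩
    · exact absurd h (H.arc_avoid _ (hmem i) v)
    · exact H.vpos_inj hwv ▸ hw
  · rcases hsplit i x hi with h | ⟨w, -, rfl⟩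
    · rcases hsplit j x hj with h' | ⟨w, -, rfl⟩
      · have := H.arc_disjoint _ (hmem i) _ (hmem j) (hinj.ne hij)
        exact absurd (Set.mem_inter h h') (this ▸ Set.notMem_empty x)
      · exact ⟨w, rfl⟩
    · exact ⟨w, rfl⟩

end Planar

/-- In a bipartite graph, if each edge is assigned to one of its ends so that every vertex receives
at most two edges, the edges split into four classes, in each of which the edges are pairwise
distinguished by their ends in one fixed side of the bipartition. -/
theorem exists_fin_four_coloring_of_card_le {V ι : Type*} [DecidableEq V] {src tgt : ι → V}
    (hcard : ∀ s : Finset ι, s.card ≤ 2 * (s.image src ∪ s.image tgt).card) :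
    ∃ κ : ι → Fin 4, ∀ k, (∀ i j, κ i = k → κ j = k → src i = src j → i = j) ∨
      (∀ i j, κ i = k → κ j = k → tgt i = tgt j → i = j) := by
  classical
  obtain ⟨f, hf, hmem⟩ := (Finset.all_card_le_biUnion_card_iff_exists_injective
    fun i => ({src i, tgt i} : Finset V) ×ˢ (Finset.univ : Finset (Fin 2))).1 fun s => by
      have h : s.biUnion (fun i => ({src i, tgt i} : Finset V) ×ˢ (Finset.univ : Finset (Fin 2))) =
          (s.image src ∪ s.image tgt) ×ˢ Finset.univ := by
        ext ⟨v, b⟩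
        simp only [Finset.mem_biUnion, Finset.mem_product, Finset.mem_insert,
          Finset.mem_singleton, Finset.mem_univ, and_true, Finset.mem_union, Finset.mem_image]
        constructor
        · rintro ⟨i, hi, rfl | rfl⟩
          exacts [Or.inl ⟨i, hi, rfl⟩, Or.inr ⟨i, hi, rfl⟩]
        · rintro (⟨i, hi, rfl⟩ | ⟨i, hi, rfl⟩)
          exacts [⟨i, hi, Or.inl rfl⟩, ⟨i, hi, Or.inr rfl⟩]
      rw [h, Finset.card_product, Finset.card_univ, Fintype.card_fin, mul_comm]
      exact hcard s
  have hf1 : ∀ i, (f i).1 = src i ∨ (f i).1 = tgt i := fun i => by simpa using hmem i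
  let side : ι → Fin 2 := fun i => if (f i).1 = src i then 0 else 1
  refine ⟨fun i => finProdFinEquiv ((f i).2, side i), fun k => ?_⟩
  obtain ⟨⟨a, b⟩, rfl⟩ := (finProdFinEquiv (m := 2) (n := 2)).surjective k
  simp only [EmbeddingLike.apply_eq_iff_eq, Prod.mk.injEq]
  by_cases hb : b = 0
  · have hsrc : ∀ i, side i = b → (f i).1 = src i := by
      intro i hi
      by_contra h
      simp [side, h, hb] at hi
    exact Or.inl fun i j hi hj hij => hf (Prod.ext (by rw [hsrc i hi.2, hsrc j hj.2, hij])
      (hi.1.trans hj.1.symm))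
  · have htgt : ∀ i, side i = b → (f i).1 = tgt i := by
      intro i hi
      refine (hf1 i).resolve_left fun h => hb ?_
      rw [← hi]
      simp [side, h]
    exact Or.inr fun i j hi hj hij => hf (Prod.ext (by rw [htgt i hi.2, htgt j hj.2, hij])
      (hi.1.trans hj.1.symm))

/-- Every bipartite planar graph has star arboricity at most 4: its edge
set can be partitioned into at most 4 star forests. -/
theorem starArboricity_bipartite_planar_le_four {V : Type*} [Fintype V]
    (G : SimpleGraph V) (hplanar : IsPlanar G) (hbip : G.Colorable 2) :
    ∃ F : Fin 4 → SimpleGraph V,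
      (∀ i, F i ≤ G ∧ IsStarForest (F i)) ∧
      ∀ e ∈ G.edgeSet, ∃! i, e ∈ (F i).edgeSet := by
  classical
  obtain ⟨H⟩ := hplanar
  obtain ⟨c⟩ := hbip
  let ι := {e : V × V // G.Adj e.1 e.2 ∧ c e.1 = 0}
  have hne : ∀ {u v}, G.Adj u v → c u = 0 → c v ≠ 0 := fun h h0 h1 => c.valid h (h0.trans h1.symm)
  have hsides : ∀ i j : ι, i.1.1 ≠ j.1.2 := fun i j hij =>
    hne j.2.1 j.2.2 (hij ▸ i.2.2)
  have hinj : Function.Injective fun i : ι => s(i.1.1, i.1.2) := by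
    intro i j hij
    rcases Sym2.eq_iff.1 hij with ⟨h1, h2⟩ | ⟨h1, -⟩
    · exact Subtype.ext (Prod.ext h1 h2)
    · exact absurd h1 (hsides i j)
  have hcard : ∀ s : Finset ι, s.card ≤
      2 * (s.image (fun i => i.1.1) ∪ s.image fun i => i.1.2).card := by
    intro s
    obtain ⟨B, hB⟩ := H.exists_isGridMinor (src := fun i : s => i.1.1.1)
      (tgt := fun i : s => i.1.1.2) (fun i => i.1.2.1) (hinj.comp Subtype.val_injective)
    have h := hB.card_le (fun i j => hsides i.1 j.1)
      fun i j h1 h2 => Subtype.ext (Subtype.ext (Prod.ext h1 h2))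
    rw [Fintype.card_coe] at h
    refine h.trans (Nat.mul_le_mul_left 2 (Finset.card_le_card (Finset.union_subset_union ?_ ?_)))
    all_goals
      intro v hv
      obtain ⟨i, -, rfl⟩ := Finset.mem_image.1 hv
      exact Finset.mem_image.2 ⟨i.1, i.2, rfl⟩
  obtain ⟨κ, hκ⟩ := exists_fin_four_coloring_of_card_le hcard
  let F : Fin 4 → SimpleGraph V := fun k =>
    { Adj := fun u v => ∃ i : ι, κ i = k ∧ s(i.1.1, i.1.2) = s(u, v)
      symm := ⟨fun u v ⟨i, hi, h⟩ => ⟨i, hi, h.trans Sym2.eq_swap⟩⟩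
      loopless := ⟨fun u ⟨i, _, h⟩ => by
        have := i.2.1.ne
        simp only [Sym2.eq_iff, or_self] at h
        exact this (h.1.trans h.2.symm)⟩ }
  refine ⟨F, fun k => ⟨?_, ?_⟩, ?_⟩
  · rintro u v ⟨i, -, h⟩
    rw [← SimpleGraph.mem_edgeSet, ← h]
    exact i.2.1
  · have hleaf : ∀ i : ι, κ i = k → (∀ x, (F k).Adj i.1.1 x → x = i.1.2) ∨
        (∀ x, (F k).Adj i.1.2 x → x = i.1.1) := by
      intro i hi
      rcases hκ k with h | h
      · refine Or.inl fun x ⟨j, hj, hjx⟩ => ?_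
        rcases Sym2.eq_iff.1 hjx with ⟨h1, h2⟩ | ⟨-, h2⟩
        · rw [← h2, h j i hj hi h1]
        · exact absurd h2.symm (hsides i j)
      · refine Or.inr fun x ⟨j, hj, hjx⟩ => ?_
        rcases Sym2.eq_iff.1 hjx with ⟨h1, -⟩ | ⟨h1, h2⟩
        · exact absurd h1 (hsides j i)
        · rw [← h1, h j i hj hi h2]
    rintro u v ⟨i, hi, h⟩
    rcases Sym2.eq_iff.1 h with ⟨rfl, rfl⟩ | ⟨rfl, rfl⟩
    · exact hleaf i hi
    · exact (hleaf i hi).symm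
  · intro e he
    have hrep : ∃ i : ι, s(i.1.1, i.1.2) = e := by
      induction e using Sym2.ind with
      | _ u v =>
        have huv : G.Adj u v := he
        by_cases hu : c u = 0
        · exact ⟨⟨(u, v), huv, hu⟩, rfl⟩
        · have hv : c v = 0 := by
            have := c.valid huv
            omega
          exact ⟨⟨(v, u), huv.symm, hv⟩, Sym2.eq_swap⟩
    obtain ⟨i, rfl⟩ := hrep
    refine ⟨κ i, ⟨i, rfl, rfl⟩, ?_⟩
    rintro k ⟨j, rfl, hj⟩
    rw [hinj hj]
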